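/- Let q : ℝ → ℝ be a probability density function that is symmetric (q(−x) = q(x)), unimodal (nonincreasing on [0, ∞)), and vanishes outside [−A/2, A/2), where A > 0. Let M ≥ 1 be an integer, define d(x) = Σ_{k=0}^{M−1} (A/M) q( (x + k·A/M) mod A ), d_min = 1 − (A/M) q(0), and d_max = 1 + (A/M) q(0), and assume d_min > 0. Define p(x) = q(x)/d(x) for x ∈ [−A/2, A/2) and p(x) = 0 otherwise, and let P_X = ∫_ℝ x² p(x) dx and E_q[X²] = ∫_ℝ x² q(x) dx. Then E_q[X²]/d_max ≤ P_X ≤ E_q[X²]/d_min. -/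

import Mathlib

open MeasureTheory

/-- `smod x A` is the representative of `x` modulo `A` in `[-A/2, A/2)`,
i.e. `x - k' A` where `k'` is the unique integer with `x - k' A ∈ [-A/2, A/2)`.
(For `A > 0`, `round (x / A)` is exactly this integer `k'`.) -/
noncomputable def smod (x A : ℝ) : ℝ := x - A * (round (x / A) : ℤ)

theorem measurable_smod (A : ℝ) : Measurable fun x => smod x A := by
  have h : ∀ x, smod x A = x - A * (⌊x / A + 1 / 2⌋ : ℤ) := fun x => by
    rw [smod, round_eq]
  simp only [h]
  have h1 : Measurable fun x : ℝ => ⌊x / A + 1 / 2⌋ := by fun_prop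
  have h2 : Measurable fun n : ℤ => (n : ℝ) := measurable_from_top
  exact measurable_id.sub (measurable_const.mul (h2.comp h1))

theorem smod_add_int_mul {A : ℝ} (hA : 0 < A) (x : ℝ) (n : ℤ) :
    smod (x + n * A) A = smod x A := by
  have h : (x + n * A) / A = x / A + n := by field_simp
  rw [smod, smod, h, round_add_intCast]
  push_cast
  ring

theorem smod_of_lt_half {A t : ℝ} (hA : 0 < A) (h0 : 0 ≤ t) (ht : t < A / 2) :
    smod t A = t := by
  have h1 : t / A < 1 / 2 := by rw [div_lt_iff₀ hA]; linarith
  have h2 : 0 ≤ t / A := by positivity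
  have h : round (t / A) = 0 := by
    rw [round_eq, Int.floor_eq_iff]
    constructor <;> push_cast <;> linarith
  simp [smod, h]

theorem smod_of_half_le {A t : ℝ} (hA : 0 < A) (h0 : A / 2 ≤ t) (ht : t < A) :
    smod t A = t - A := by
  have h1 : 1 / 2 ≤ t / A := by rw [le_div_iff₀ hA]; linarith
  have h2 : t / A < 1 := by rwa [div_lt_one hA]
  have h : round (t / A) = 1 := by
    rw [round_eq, Int.floor_eq_iff]
    constructor <;> push_cast <;> linarith
  simp [smod, h]

/-- On `[0, A)` the periodization of an even function supported in `[-A/2, A/2)` is the sum of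
two translates. -/
theorem apply_smod_eq_add {q : ℝ → ℝ} {A : ℝ} (hA : 0 < A) (hqs : ∀ x : ℝ, q (-x) = q x)
    (hqv : ∀ x : ℝ, x ∉ Set.Ico (-(A / 2)) (A / 2) → q x = 0) {t : ℝ}
    (h0 : 0 ≤ t) (ht : t < A) : q (smod t A) = q t + q (A - t) := by
  rcases lt_or_ge t (A / 2) with h | h
  · rw [smod_of_lt_half hA h0 h, hqv (A - t) (fun hh => by linarith [hh.2]), add_zero]
  · rw [smod_of_half_le hA h ht, hqv t (fun hh => by linarith [hh.2]), zero_add, ← hqs]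
    congr 1
    ring

/-- Half of the mass of an even function lies on the positive half-line. -/
theorem intervalIntegral_eq_half_of_even {q : ℝ → ℝ} {c : ℝ} (hi : Integrable q)
    (hqs : ∀ x : ℝ, q (-x) = q x) (hs : Function.support q ⊆ Set.Ioc (-c) c) :
    (∫ x in (0 : ℝ)..c, q x) = (∫ x, q x) / 2 := by
  have h1 := intervalIntegral.integral_eq_integral_of_support_subset (μ := volume) hs
  have h2 : (∫ x in (-c)..0, q x) = ∫ x in (0 : ℝ)..c, q x := by
    have := intervalIntegral.integral_comp_neg (a := 0) (b := c) q
    simpa [hqs] using this.symm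
  have h3 := intervalIntegral.integral_add_adjacent_intervals
    (hi.intervalIntegrable (a := -c) (b := 0)) (hi.intervalIntegrable (a := 0) (b := c))
  linarith

/-- Riemann sum bounds for an antitone function sampled with step `h` from `a ∈ [0, h]`. -/
theorem riemann_sum_bounds {q : ℝ → ℝ} (hq0 : ∀ x : ℝ, 0 ≤ q x) (hi : Integrable q)
    (hqu : AntitoneOn q (Set.Ici (0 : ℝ))) {h a : ℝ} (hh : 0 < h) (ha : 0 ≤ a) (hah : a ≤ h)
    (M : ℕ) :
    (∫ x in (0 : ℝ)..(a + M * h), q x) - a * q 0 ≤ ∑ k ∈ Finset.range M, h * q (a + k * h) ∧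
      ∑ k ∈ Finset.range M, h * q (a + k * h)
        ≤ (∫ x in (0 : ℝ)..(a + M * h), q x) + (h - a) * q 0 := by
  have hanti : AntitoneOn (fun t => q (h * t)) (Set.Icc (a / h) (a / h + M)) := by
    intro x hx y hy hxy
    have hx0 : 0 ≤ x := le_trans (by positivity) hx.1
    exact hqu (Set.mem_Ici.2 (by positivity))
      (Set.mem_Ici.2 (mul_nonneg hh.le (hx0.trans hxy))) (by gcongr)
  have e : ∀ k : ℕ, h * (a / h + k) = a + k * h := fun k => by field_simp
  have hJ : h * (∫ t in (a / h)..(a / h + M), q (h * t)) = ∫ x in a..(a + M * h), q x := by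
    rw [intervalIntegral.mul_integral_comp_mul_left, e]
    congr 1
    field_simp
  have hup := mul_le_mul_of_nonneg_left hanti.sum_le_integral hh.le
  have hlo := mul_le_mul_of_nonneg_left hanti.integral_le_sum hh.le
  simp only [e, hJ, Finset.mul_sum] at hup hlo
  have hshift := Finset.sum_range_succ (fun k : ℕ => h * q (a + k * h)) M
  rw [Finset.sum_range_succ'] at hshift
  have hsplit := intervalIntegral.integral_add_adjacent_intervals
    (hi.intervalIntegrable (a := 0) (b := a)) (hi.intervalIntegrable (a := a) (b := a + M * h))
  have hle : (∫ x in (0 : ℝ)..a, q x) ≤ a * q 0 := by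
    have := intervalIntegral.integral_mono_on ha (hi.intervalIntegrable (a := 0) (b := a))
      intervalIntegrable_const (g := fun _ => q 0)
      (fun x hx => hqu (Set.mem_Ici.2 le_rfl) (Set.mem_Ici.2 hx.1) hx.1)
    simpa using this
  have hge : a * q a ≤ ∫ x in (0 : ℝ)..a, q x := by
    have := intervalIntegral.integral_mono_on ha (f := fun _ => q a) intervalIntegrable_const
      (hi.intervalIntegrable (a := 0) (b := a))
      (fun x hx => hqu (Set.mem_Ici.2 hx.1) (Set.mem_Ici.2 ha) hx.2)
    simpa using this
  have hqa : (h - a) * q a ≤ (h - a) * q 0 :=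
    mul_le_mul_of_nonneg_left (hqu (Set.mem_Ici.2 le_rfl) (Set.mem_Ici.2 ha) ha) (by linarith)
  have hend : 0 ≤ h * q (a + M * h) := mul_nonneg hh.le (hq0 _)
  simp only [Nat.cast_zero, zero_mul, add_zero] at hshift
  constructor <;> linarith

/-- Shifting by one step permutes the sample points modulo `A`. -/
theorem periodic_sum_smod (q : ℝ → ℝ) {A : ℝ} (hA : 0 < A) {M : ℕ} (hM : 1 ≤ M) :
    Function.Periodic
      (fun x => ∑ k ∈ Finset.range M, (A / M) * q (smod (x + (k : ℝ) * (A / M)) A)) (A / M) := by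
  intro x
  have hM0 : (M : ℝ) ≠ 0 := by positivity
  have hs := Finset.sum_range_succ
    (fun k : ℕ => (A / M) * q (smod (x + (k : ℝ) * (A / M)) A)) M
  rw [Finset.sum_range_succ'] at hs
  have hlast : smod (x + (M : ℝ) * (A / M)) A = smod x A := by
    rw [mul_div_cancel₀ _ hM0]
    simpa using smod_add_int_mul hA x 1
  simp only [hlast, Nat.cast_zero, zero_mul, add_zero, add_left_inj] at hs
  beta_reduce
  rw [← hs]
  refine Finset.sum_congr rfl fun k _ => ?_
  push_cast
  congr 3
  ring

theorem sum_smod_bounds {q : ℝ → ℝ} {A : ℝ} (hA : 0 < A)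
    (hq0 : ∀ x : ℝ, 0 ≤ q x) (hq1 : (∫ x : ℝ, q x) = 1) (hi : Integrable q)
    (hqs : ∀ x : ℝ, q (-x) = q x) (hqu : AntitoneOn q (Set.Ici (0 : ℝ)))
    (hqv : ∀ x : ℝ, x ∉ Set.Ico (-(A / 2)) (A / 2) → q x = 0)
    {M : ℕ} (hM : 1 ≤ M) (x : ℝ) :
    1 - (A / M) * q 0 ≤ ∑ k ∈ Finset.range M, (A / M) * q (smod (x + (k : ℝ) * (A / M)) A) ∧
      ∑ k ∈ Finset.range M, (A / M) * q (smod (x + (k : ℝ) * (A / M)) A)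
        ≤ 1 + (A / M) * q 0 := by
  have hMpos : (0 : ℝ) < M := by positivity
  have hh : 0 < A / M := by positivity
  obtain ⟨a, ⟨ha0, hah⟩, hxa⟩ := (periodic_sum_smod q hA hM).exists_mem_Ico₀ hh x
  rw [hxa]
  have hMh : (M : ℝ) * (A / M) = A := mul_div_cancel₀ _ hMpos.ne'
  have hsum : ∑ k ∈ Finset.range M, (A / M) * q (smod (a + (k : ℝ) * (A / M)) A)
      = ∑ k ∈ Finset.range M, (A / M) * q (a + k * (A / M))
        + ∑ k ∈ Finset.range M, (A / M) * q ((A / M - a) + k * (A / M)) := by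
    rw [← Finset.sum_range_reflect (fun k : ℕ => (A / M) * q ((A / M - a) + k * (A / M))) M,
      ← Finset.sum_add_distrib]
    refine Finset.sum_congr rfl fun k hk => ?_
    have hk' : k + 1 ≤ M := Finset.mem_range.1 hk
    have hkr : ((k : ℝ) + 1) * (A / M) ≤ M * (A / M) := by
      gcongr
      exact_mod_cast hk'
    have hlt : a + (k : ℝ) * (A / M) < A := by linarith
    have hcast : ((M - 1 - k : ℕ) : ℝ) = M - 1 - k := by
      rw [Nat.sub_sub, Nat.cast_sub (by omega)]
      push_cast
      ring
    rw [apply_smod_eq_add hA hqs hqv (by positivity) hlt, hcast, mul_add]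
    congr 3
    linear_combination -hMh
  have hhalf : ∀ b : ℝ, 0 ≤ b → (∫ x in (0 : ℝ)..(b + M * (A / M)), q x) = 1 / 2 := by
    intro b hb
    rw [hMh, intervalIntegral_eq_half_of_even hi hqs, hq1]
    intro y hy
    have := not_imp_comm.1 (hqv y) hy
    exact ⟨by linarith [this.1], by linarith [this.2]⟩
  have h1 := riemann_sum_bounds hq0 hi hqu hh ha0 hah.le M
  have h2 := riemann_sum_bounds hq0 hi hqu hh (a := A / M - a) (by linarith) (by linarith) M
  rw [hhalf _ ha0] at h1
  rw [hhalf _ (by linarith)] at h2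
  rw [hsum]
  constructor <;> linarith [h1.1, h1.2, h2.1, h2.2]

/-- Power relation (14) of the paper: with `d(x)`, `d_min = 1 - (A/M) q(0)`,
`d_max = 1 + (A/M) q(0)`, `p(x) = q(x)/d(x)` on `[-A/2, A/2)` (zero elsewhere),
`P_X = ∫ x² p(x) dx`, and `E_q[X²] = ∫ x² q(x) dx`, one has
`E_q[X²]/d_max ≤ P_X ≤ E_q[X²]/d_min`. -/
theorem power_bounds
    (q : ℝ → ℝ) (A : ℝ) (hA : 0 < A)
    (hq0 : ∀ x : ℝ, 0 ≤ q x) (hqm : Measurable q)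
    (hq1 : (∫ x : ℝ, q x) = 1)
    (hqs : ∀ x : ℝ, q (-x) = q x)
    (hqu : AntitoneOn q (Set.Ici (0 : ℝ)))
    (hqv : ∀ x : ℝ, x ∉ Set.Ico (-(A / 2)) (A / 2) → q x = 0)
    (M : ℕ) (hM : 1 ≤ M)
    (d : ℝ → ℝ)
    (hd : ∀ x : ℝ,
      d x = ∑ k ∈ Finset.range M, (A / M) * q (smod (x + (k : ℝ) * (A / M)) A))
    (hdmin : 0 < 1 - (A / M) * q 0)
    (p : ℝ → ℝ)
    (hp : ∀ x : ℝ, p x = if x ∈ Set.Ico (-(A / 2)) (A / 2) then q x / d x else 0) :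
    (∫ x : ℝ, x ^ 2 * q x) / (1 + (A / M) * q 0) ≤ (∫ x : ℝ, x ^ 2 * p x)
      ∧ (∫ x : ℝ, x ^ 2 * p x) ≤ (∫ x : ℝ, x ^ 2 * q x) / (1 - (A / M) * q 0) := by
  have hi : Integrable q := by
    by_contra h
    simp [integral_undef h] at hq1
  have hbd : ∀ x, 1 - (A / M) * q 0 ≤ d x ∧ d x ≤ 1 + (A / M) * q 0 := fun x => by
    rw [hd]
    exact sum_smod_bounds hA hq0 hq1 hi hqs hqu hqv hM x
  have hdpos : ∀ x, 0 < d x := fun x => hdmin.trans_le (hbd x).1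
  have hpq : ∀ x, p x = q x / d x := fun x => by
    rw [hp]
    split_ifs with hx
    · rfl
    · rw [hqv x hx, zero_div]
  have hdm : Measurable d := by
    rw [funext hd]
    refine Finset.measurable_sum _ fun k _ => measurable_const.mul (hqm.comp ?_)
    exact (measurable_smod A).comp (measurable_id.add_const _)
  have hpm : Measurable p := by
    rw [funext hpq]
    exact hqm.div hdm
  have hi2 : Integrable fun x => x ^ 2 * q x := by
    refine (hi.const_mul (A ^ 2)).mono' (by fun_prop) (ae_of_all _ fun x => ?_)
    rw [Real.norm_of_nonneg (mul_nonneg (sq_nonneg x) (hq0 x))]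
    by_cases hx : x ∈ Set.Ico (-(A / 2)) (A / 2)
    · have : x ^ 2 ≤ A ^ 2 := sq_le_sq' (by linarith [hx.1]) (by linarith [hx.2])
      exact mul_le_mul_of_nonneg_right this (hq0 x)
    · simp [hqv x hx]
  have hup : ∀ x, x ^ 2 * p x ≤ x ^ 2 * q x / (1 - (A / M) * q 0) := fun x => by
    rw [hpq, mul_div_assoc]
    exact mul_le_mul_of_nonneg_left
      (div_le_div_of_nonneg_left (hq0 x) hdmin (hbd x).1) (sq_nonneg x)
  have hlo : ∀ x, x ^ 2 * q x / (1 + (A / M) * q 0) ≤ x ^ 2 * p x := fun x => by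
    rw [hpq, mul_div_assoc]
    exact mul_le_mul_of_nonneg_left
      (div_le_div_of_nonneg_left (hq0 x) (hdpos x) (hbd x).2) (sq_nonneg x)
  have hnn : ∀ x, 0 ≤ x ^ 2 * p x := fun x => by
    rw [hpq]
    exact mul_nonneg (sq_nonneg x) (div_nonneg (hq0 x) (hdpos x).le)
  have hip : Integrable fun x => x ^ 2 * p x :=
    (hi2.div_const _).mono' (by fun_prop) (ae_of_all _ fun x => by
      rw [Real.norm_of_nonneg (hnn x)]
      exact hup x)
  rw [← integral_div, ← integral_div]
  exact ⟨integral_mono (hi2.div_const _) hip hlo, integral_mono hip (hi2.div_const _) hup⟩
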